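/- arXiv:1210.3255 — 2 statements merged into one kernel-verified Lean document; each statement's English description precedes it below -/
import Mathlib

section
/- Let B and A be reduced commutative ℂ-algebras of finite type, let φ : B → A be a ℂ-algebra homomorphism, and let p ≥ 1. Let L : ⋀_B^p Ω_{B/ℂ} → ⋀_A^p Ω_{A/ℂ} be the unique B-linear map (the target viewed as a B-module via φ) satisfying L((d b₁) ∧ ⋯ ∧ (d b_p)) = (d φ(b₁)) ∧ ⋯ ∧ (d φ(b_p)) for all b₁, …, b_p ∈ B. Then L maps the torsion submodule of the B-module ⋀_B^p Ω_{B/ℂ} into the torsion submodule of the A-module ⋀_A^p Ω_{A/ℂ}. (Affine form of Proposition 2.4: pull-backs of torsion differential p-forms are torsion.) -/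
/-- Restriction of scalars of an alternating map along `A → F`. -/
def alternatingRestrictScalars (A : Type*) {F N M ι : Type*} [CommRing A] [CommRing F]
    [Algebra A F] [AddCommGroup N] [AddCommGroup M] [Module A N] [Module F N] [Module A M]
    [Module F M] [IsScalarTower A F N] [IsScalarTower A F M] (g : N [⋀^ι]→ₗ[F] M) :
    N [⋀^ι]→ₗ[A] M where
  toMultilinearMap := g.toMultilinearMap.restrictScalars A
  map_eq_zero_of_eq' := g.map_eq_zero_of_eq'

section DetForm

variable {R A F : Type*} [CommRing R] [CommRing A] [CommRing F]
  [Algebra R A] [Algebra R F] [Algebra A F] [IsScalarTower R A F] {p : ℕ}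

theorem exteriorPower_kaehler_hom_ext {N : Type*} [AddCommGroup N] [Module A N]
    {f g : ⋀[A]^p (Ω[A⁄R]) →ₗ[A] N}
    (h : ∀ a : Fin p → A,
      f (exteriorPower.ιMulti A p fun i => KaehlerDifferential.D R A (a i)) =
        g (exteriorPower.ιMulti A p fun i => KaehlerDifferential.D R A (a i))) : f = g := by
  refine LinearMap.ext_on
    (exteriorPower.ιMulti_span_of_span A p _ (KaehlerDifferential.span_range_derivation R A)) ?_
  rintro _ ⟨v, hv, rfl⟩
  choose a ha using fun i => hv ⟨i, rfl⟩
  obtain rfl : (fun i => KaehlerDifferential.D R A (a i)) = v := funext ha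
  exact h a

/-- The linear form `da₁ ∧ ⋯ ∧ daₚ ↦ det (dᵢ aⱼ)` attached to derivations `d₁, …, dₚ`. -/
noncomputable def detForm (d : Fin p → Derivation R A F) :
    ⋀[A]^p (Ω[A⁄R]) →ₗ[A] F :=
  exteriorPower.alternatingMapLinearEquiv
    ((alternatingRestrictScalars A
      (Matrix.detRowAlternating (n := Fin p) (R := F))).compLinearMap
        (LinearMap.pi fun i => (d i).liftKaehlerDifferential))

theorem detForm_ιMulti (d : Fin p → Derivation R A F) (a : Fin p → A) :
    detForm d (exteriorPower.ιMulti A p fun i => KaehlerDifferential.D R A (a i)) =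
      (Matrix.of fun j i => d i (a j)).det := by
  simp only [detForm, exteriorPower.alternatingMapLinearEquiv_apply_ιMulti]
  change Matrix.det _ = _
  congr 1
  ext i j
  simp [LinearMap.pi_apply]

variable (R A F p) in
/-- Pull-back of `p`-forms along the structure map `A → F`. -/
noncomputable def formPullback :
    ⋀[A]^p (Ω[A⁄R]) →ₗ[A] ⋀[F]^p (Ω[F⁄R]) :=
  exteriorPower.alternatingMapLinearEquiv
    ((alternatingRestrictScalars A (exteriorPower.ιMulti F p (M := Ω[F⁄R]))).compLinearMap
      (KaehlerDifferential.map R R A F))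

theorem formPullback_ιMulti (a : Fin p → A) :
    formPullback R A F p (exteriorPower.ιMulti A p fun i => KaehlerDifferential.D R A (a i)) =
      exteriorPower.ιMulti F p fun i => KaehlerDifferential.D R F (algebraMap A F (a i)) := by
  simp only [formPullback, exteriorPower.alternatingMapLinearEquiv_apply_ιMulti]
  change exteriorPower.ιMulti F p _ = _
  congr 1
  ext i
  simp

variable {G : Type*} [CommRing G] [Algebra R G] [Algebra A G] [Algebra F G]
  [IsScalarTower R A G] [IsScalarTower A F G]

theorem detForm_map (d : Fin p → Derivation R A F) (d' : Fin p → Derivation R A G)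
    (h : ∀ i a, d' i a = algebraMap F G (d i a)) (z : ⋀[A]^p (Ω[A⁄R])) :
    detForm d' z = algebraMap F G (detForm d z) := by
  have : detForm d' = (IsScalarTower.toAlgHom A F G).toLinearMap ∘ₗ detForm d := by
    refine exteriorPower_kaehler_hom_ext fun a => ?_
    simp only [LinearMap.comp_apply, detForm_ιMulti]
    simp only [AlgHom.toLinearMap_apply, IsScalarTower.coe_toAlgHom', RingHom.map_det]
    congr 1
    ext i j
    simp [h]
  rw [this]
  rfl

variable [IsScalarTower R F G]

theorem detForm_formPullback (d : Fin p → Derivation R F G) (z : ⋀[A]^p (Ω[A⁄R])) :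
    detForm d (formPullback R A F p z) = detForm (fun i => (d i).compAlgebraMap A) z := by
  have : (detForm d).restrictScalars A ∘ₗ formPullback R A F p =
      detForm (fun i => (d i).compAlgebraMap A) := by
    refine exteriorPower_kaehler_hom_ext fun a => ?_
    simp only [LinearMap.comp_apply, formPullback_ιMulti, LinearMap.restrictScalars_apply,
      detForm_ιMulti]
    rfl
  exact LinearMap.congr_fun this z

theorem formPullback_comp (z : ⋀[A]^p (Ω[A⁄R])) :
    formPullback R F G p (formPullback R A F p z) = formPullback R A G p z := by
  have : (formPullback R F G p).restrictScalars A ∘ₗ formPullback R A F p =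
      formPullback R A G p := by
    refine exteriorPower_kaehler_hom_ext fun a => ?_
    simp only [LinearMap.comp_apply, formPullback_ιMulti, LinearMap.restrictScalars_apply,
      ← IsScalarTower.algebraMap_apply]
  exact LinearMap.congr_fun this z

end DetForm

theorem semilinear_eq_formPullback
    {B A : Type*} [CommRing B] [CommRing A] [Algebra ℂ B] [Algebra ℂ A]
    [Algebra B A] [IsScalarTower ℂ B A] (p : ℕ)
    (L : ⋀[B]^p (Ω[B⁄ℂ]) →ₛₗ[algebraMap B A] ⋀[A]^p (Ω[A⁄ℂ]))
    (hL : ∀ (b : Fin p → B) (x : ⋀[B]^p (Ω[B⁄ℂ])),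
      (x : ExteriorAlgebra B (Ω[B⁄ℂ])) =
          ExteriorAlgebra.ιMulti B p (fun i => KaehlerDifferential.D ℂ B (b i)) →
        (L x : ExteriorAlgebra A (Ω[A⁄ℂ])) =
          ExteriorAlgebra.ιMulti A p
            (fun i => KaehlerDifferential.D ℂ A (algebraMap B A (b i))))
    (z : ⋀[B]^p (Ω[B⁄ℂ])) : L z = formPullback ℂ B A p z := by
  let L' : ⋀[B]^p (Ω[B⁄ℂ]) →ₗ[B] ⋀[A]^p (Ω[A⁄ℂ]) :=
    { toFun := L
      map_add' := map_add L
      map_smul' := fun b x => by rw [map_smulₛₗ, algebraMap_smul, RingHom.id_apply] }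
  have : L' = formPullback ℂ B A p := by
    refine exteriorPower_kaehler_hom_ext fun b => ?_
    rw [formPullback_ιMulti]
    exact Subtype.ext (hL b _ rfl)
  exact LinearMap.congr_fun this z

theorem Algebra.FormallySmooth.of_charZero_field (K L : Type*) [Field K] [Field L] [CharZero K]
    [Algebra K L] : Algebra.FormallySmooth K L := by
  obtain ⟨s, hs⟩ := exists_isTranscendenceBasis K L
  have := hs.isAlgebraic_field
  exact .of_algebraicIndependent_of_isSeparable hs.1

theorem Derivation.exists_extend {R K L : Type*} [CommRing R] [Field K] [Field L] [CharZero K]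
    [Algebra R K] [Algebra R L] [Algebra K L] [IsScalarTower R K L] (d : Derivation R K K) :
    ∃ d' : Derivation R L L, ∀ x, d' (algebraMap K L x) = algebraMap K L (d x) := by
  have := Algebra.FormallySmooth.of_charZero_field K L
  have hinj : LinearMap.ker (KaehlerDifferential.mapBaseChange R K L) = ⊥ := by
    rw [LinearMap.ker_eq_bot, injective_iff_map_eq_zero]
    intro x hx
    obtain ⟨x, rfl⟩ := (Algebra.H1Cotangent.exact_δ_mapBaseChange R K L x).mp hx
    rw [Subsingleton.elim x 0, map_zero]
  obtain ⟨r, hr⟩ := LinearMap.exists_leftInverse_of_injective _ hinj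
  let l : TensorProduct K L (Ω[K⁄R]) →ₗ[L] L :=
    TensorProduct.AlgebraTensorModule.lift
      ((LinearMap.toSpanSingleton L _ ((Algebra.linearMap K L) ∘ₗ d.liftKaehlerDifferential)))
  refine ⟨(l ∘ₗ r).compDer (KaehlerDifferential.D R L), fun x => ?_⟩
  have h : KaehlerDifferential.D R L (algebraMap K L x) =
      KaehlerDifferential.mapBaseChange R K L (1 ⊗ₜ KaehlerDifferential.D R K x) := by
    simp
  have h2 := LinearMap.congr_fun hr (1 ⊗ₜ KaehlerDifferential.D R K x)
  simp only [LinearMap.comp_apply, LinearMap.id_apply] at h2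
  change l (r (KaehlerDifferential.D R L (algebraMap K L x))) = _
  rw [h, h2]
  simp [l]

theorem exists_smul_mem_span_of_localization
    {A K N N' I : Type*} [CommRing A] [CommRing K] [Algebra A K] (M : Submonoid A)
    [IsLocalization M K] [AddCommGroup N] [Module A N] [AddCommGroup N'] [Module A N']
    [Module K N'] [IsScalarTower A K N'] (f : N →ₗ[A] N') [IsLocalizedModule M f]
    (e : I → N) (he : ⊤ ≤ Submodule.span K (Set.range (f ∘ e))) (w : N) :
    ∃ s ∈ M, s • w ∈ Submodule.span A (Set.range e) := by
  have h1 : ∀ y ∈ Submodule.span K (Set.range (f ∘ e)),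
      ∃ s ∈ M, ∃ u ∈ Submodule.span A (Set.range e), s • y = f u := by
    intro y hy
    induction hy using Submodule.span_induction with
    | mem x hx =>
      obtain ⟨i, rfl⟩ := hx
      exact ⟨1, M.one_mem, e i, Submodule.subset_span ⟨i, rfl⟩, by simp⟩
    | zero => exact ⟨1, M.one_mem, 0, zero_mem _, by simp⟩
    | add x y _ _ hx hy =>
      obtain ⟨s, hs, u, hu, h⟩ := hx
      obtain ⟨t, ht, v, hv, h'⟩ := hy
      refine ⟨s * t, M.mul_mem hs ht, t • u + s • v,
        add_mem (Submodule.smul_mem _ _ hu) (Submodule.smul_mem _ _ hv), ?_⟩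
      rw [map_add, map_smul, map_smul, ← h, ← h', smul_add, mul_comm s t, mul_smul, mul_comm t s,
        mul_smul]
    | smul a x _ hx =>
      obtain ⟨s, hs, u, hu, h⟩ := hx
      obtain ⟨⟨b, t⟩, hb⟩ := IsLocalization.surj M a
      refine ⟨t * s, M.mul_mem t.2 hs, b • u, Submodule.smul_mem _ _ hu, ?_⟩
      rw [map_smul, ← h, ← algebraMap_smul K b, ← hb, ← algebraMap_smul K (t * s : A),
        ← algebraMap_smul K s, smul_smul, smul_smul, map_mul]
      congr 1
      ring
  obtain ⟨s, hs, u, hu, h⟩ := h1 (f w) (he Submodule.mem_top)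
  rw [← map_smul, IsLocalizedModule.eq_iff_exists M f] at h
  obtain ⟨c, hc⟩ := h
  refine ⟨c * s, M.mul_mem c.2 hs, ?_⟩
  rw [mul_smul]
  change c • s • w ∈ _
  rw [hc]
  exact Submodule.smul_mem _ (c : A) hu

theorem exists_smul_mem_span_ιMulti_family {A N I : Type*} [CommRing A] (M : Submonoid A)
    [AddCommGroup N] [Module A N] [LinearOrder I] (e : I → N)
    (he : ∀ w : N, ∃ s ∈ M, s • w ∈ Submodule.span A (Set.range e)) {p : ℕ} (z : ⋀[A]^p N) :
    ∃ s ∈ M, s • z ∈ Submodule.span A (Set.range (exteriorPower.ιMulti_family A p e)) := by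
  have hz : z ∈ Submodule.span A (Set.range (exteriorPower.ιMulti A p (M := N))) := by
    rw [exteriorPower.ιMulti_span]; trivial
  induction hz using Submodule.span_induction with
  | mem x hx =>
    obtain ⟨v, rfl⟩ := hx
    choose s hs hv using he
    refine ⟨∏ i, s (v i), prod_mem fun i _ => hs _, ?_⟩
    rw [← AlternatingMap.map_smul_univ, ← exteriorPower.ιMulti_family_span]
    refine ⟨exteriorPower.ιMulti A p fun i => ⟨s (v i) • v i, hv (v i)⟩, ?_⟩
    rw [exteriorPower.map_apply_ιMulti]
    rfl
  | zero => exact ⟨1, M.one_mem, by simp⟩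
  | add x y _ _ hx hy =>
    obtain ⟨s, hs, h⟩ := hx
    obtain ⟨t, ht, h'⟩ := hy
    refine ⟨s * t, M.mul_mem hs ht, ?_⟩
    rw [smul_add, mul_smul s t y, mul_comm, mul_smul]
    exact add_mem (Submodule.smul_mem _ _ h) (Submodule.smul_mem _ _ h')
  | smul a x _ hx =>
    obtain ⟨s, hs, h⟩ := hx
    exact ⟨s, hs, by rw [smul_comm]; exact Submodule.smul_mem _ _ h⟩

/-- A `p`-form killed by all determinants of derivations of a field that is a localization of `A`
is killed by an element of the multiplicative set. -/
theorem exists_smul_eq_zero_of_detForm_eq_zero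
    {R A K : Type*} [CommRing R] [CommRing A] [Field K] [Algebra R A] [Algebra R K] [Algebra A K]
    [IsScalarTower R A K] (M : Submonoid A) [IsLocalization M K] {p : ℕ} (z : ⋀[A]^p (Ω[A⁄R]))
    (hz : ∀ d : Fin p → Derivation R K K, detForm (fun i => (d i).compAlgebraMap A) z = 0) :
    ∃ s ∈ M, s • z = 0 := by
  have hspan : Submodule.span K
      (Set.range fun a : A => KaehlerDifferential.D R K (algebraMap A K a)) = ⊤ := by
    have := span_eq_top_of_isLocalizedModule K M (KaehlerDifferential.map R R A K)
      (KaehlerDifferential.span_range_derivation R A)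
    rwa [← Set.range_comp, Function.comp_def, funext (KaehlerDifferential.map_D R R A K)] at this
  obtain ⟨b, hbsub, hbspan, hbli⟩ := exists_linearIndependent K
    (Set.range fun a : A => KaehlerDifferential.D R K (algebraMap A K a))
  classical
  let : LinearOrder b := linearOrderOfSTO WellOrderingRel
  have : ∀ i : b, ∃ a : A, KaehlerDifferential.D R K (algebraMap A K a) = i := fun i => hbsub i.2
  choose a ha using this
  let bas : Module.Basis b K (Ω[K⁄R]) :=
    Module.Basis.mk hbli (by rw [Subtype.range_coe, hbspan, hspan])
  have hbas : ∀ i, bas i = KaehlerDifferential.D R K (algebraMap A K (a i)) := by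
    intro i; simp [bas, ha]
  obtain ⟨s, hs, hsz⟩ := exists_smul_mem_span_ιMulti_family M
    (fun i => KaehlerDifferential.D R A (a i))
    (exists_smul_mem_span_of_localization (K := K) M (KaehlerDifferential.map R R A K) _ (by
      simp only [Function.comp_def, KaehlerDifferential.map_D, ← hbas]
      exact bas.span_eq.ge)) z
  obtain ⟨c, hc⟩ := (Finsupp.mem_span_range_iff_exists_finsupp).mp hsz
  have hcoef : ∀ t, algebraMap A K (c t) = 0 := by
    intro t
    let d : Fin p → Derivation R K K := fun i =>
      (bas.coord (Set.powersetCard.ofFinEmbEquiv.symm t i)).compDer (KaehlerDifferential.D R K)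
    have hd : ∀ u, detForm (fun i => (d i).compAlgebraMap A)
        (exteriorPower.ιMulti_family A p (fun i => KaehlerDifferential.D R A (a i)) u) =
        exteriorPower.ιMultiDual K p bas t (exteriorPower.ιMulti_family K p bas u) := by
      intro u
      rw [exteriorPower.ιMulti_family, exteriorPower.ιMulti_family,
        exteriorPower.ιMultiDual_apply_ιMulti, Function.comp_def, detForm_ιMulti]
      congr 1
      ext i j
      simp only [Matrix.of_apply, Function.comp_apply, hbas]
      rfl
    have h0 := congrArg (detForm (fun i => (d i).compAlgebraMap A)) hc
    rw [map_smul, hz d, smul_zero, Finsupp.sum, map_sum, Finset.sum_eq_single t] at h0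
    · rwa [map_smul, hd, exteriorPower.ιMultiDual_apply_diag, ← Algebra.algebraMap_eq_smul_one]
        at h0
    · intro u _ hu
      rw [map_smul, hd, exteriorPower.ιMultiDual_apply_nondiag _ _ _ _ _ hu.symm, smul_zero]
    · intro ht
      rw [Finsupp.notMem_support_iff.mp ht, zero_smul, map_zero]
  have hkill : ∀ t, ∃ m : M, (m : A) * c t = 0 := fun t =>
    (IsLocalization.map_eq_zero_iff M K _).mp (hcoef t)
  choose m hm using hkill
  refine ⟨(∏ t ∈ c.support, (m t : A)) * s,
    M.mul_mem (prod_mem fun t _ => (m t).2) hs, ?_⟩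
  rw [mul_smul, ← hc, Finsupp.sum, Finset.smul_sum]
  refine Finset.sum_eq_zero fun t ht => ?_
  rw [← Finset.prod_erase_mul _ _ ht, smul_smul, mul_assoc, hm, mul_zero, zero_smul]

section CoefficientField

open Polynomial

/-- Let `S` be an `R`-algebra whose elements are polynomials in `t` with coefficients in a
coefficient field `k`, subject only to `t ^ n = 0`. Derivations of `k` extend to `S`. -/
theorem Derivation.exists_extend_of_ker_aeval {R k S : Type*} [CommRing R] [CommRing k]
    [CommRing S] [Algebra R k] [Algebra R S] [Algebra k S] [IsScalarTower R k S] (t : S) (n : ℕ)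
    (hsurj : Function.Surjective (aeval (R := k) t)) (ht : t ^ n = 0)
    (hker : ∀ f : k[X], aeval t f = 0 → X ^ n ∣ f) (d : Derivation R k k) :
    ∃ d' : Derivation R S S, d' t = 0 ∧ ∀ x, d' (algebraMap k S x) = algebraMap k S (d x) := by
  let D : Derivation R k[X] k[X] := PolynomialModule.equivPolynomialSelf.compDer d.mapCoeffs
  have hDcoeff : ∀ f i, (D f).coeff i = d (f.coeff i) := fun f i => rfl
  have hD : ∀ f, aeval t f = 0 → aeval t (D f) = 0 := by
    intro f hf
    obtain ⟨g, hg⟩ : X ^ n ∣ D f := by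
      rw [X_pow_dvd_iff]
      intro i hi
      rw [hDcoeff, X_pow_dvd_iff.mp (hker f hf) i hi, map_zero]
    rw [hg, map_mul, map_pow, aeval_X, ht, zero_mul]
  let D' : Derivation R S S := Derivation.liftOfSurjective
    (f := (aeval (R := k) t).restrictScalars R) hsurj hD
  have hD' : ∀ f, D' (aeval t f) = aeval t (D f) := fun f =>
    Derivation.liftOfSurjective_apply (f := (aeval (R := k) t).restrictScalars R) hsurj hD f
  refine ⟨D', ?_, fun x => ?_⟩
  · have := hD' X
    rw [aeval_X] at this
    rw [this]
    have : D X = 0 := by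
      ext i
      rw [hDcoeff, coeff_X]
      split_ifs <;> simp
    rw [this, map_zero]
  · have := hD' (C x)
    rw [aeval_C] at this
    rw [this]
    have : D (C x) = C (d x) := by
      ext i
      rw [hDcoeff, coeff_C, coeff_C]
      split_ifs <;> simp
    rw [this, aeval_C]

theorem Derivation.exists_lift_quotient_pow {V k : Type*} [CommRing V] [IsDomain V]
    [IsDiscreteValuationRing V] [Algebra ℂ V] [Field k] [Algebra ℂ k]
    (ρ : V →ₐ[ℂ] k) (hρ : Function.Surjective ρ) {π : V} (hπ : Irreducible π)
    (hker : RingHom.ker ρ = Ideal.span {π}) (n : ℕ)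
    (d : Derivation ℂ k k) (r : (V ⧸ Ideal.span {π ^ n}) →ₐ[ℂ] k)
    (hr : ∀ v, r (Ideal.Quotient.mk _ v) = ρ v) :
    ∃ d' : Derivation ℂ (V ⧸ Ideal.span {π ^ n}) (V ⧸ Ideal.span {π ^ n}),
      ∀ s, r (d' s) = d (r s) := by
  have hrsurj : Function.Surjective r := fun x => by
    obtain ⟨v, rfl⟩ := hρ x
    exact ⟨_, hr v⟩
  set t : V ⧸ Ideal.span {π ^ n} := Ideal.Quotient.mk _ π with ht
  have htn : t ^ n = 0 := by
    rw [ht, ← map_pow, Ideal.Quotient.eq_zero_iff_mem]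
    exact Ideal.mem_span_singleton_self _
  have hrker : ∀ s, r s = 0 → t ∣ s := by
    intro s hs
    obtain ⟨v, rfl⟩ := Ideal.Quotient.mk_surjective s
    rw [hr, ← RingHom.mem_ker, hker, Ideal.mem_span_singleton] at hs
    exact map_dvd _ hs
  have hrt : r t = 0 := by
    rw [ht, hr, ← RingHom.mem_ker, hker]
    exact Ideal.mem_span_singleton_self _
  have hnil : IsNilpotent (RingHom.ker (r : (V ⧸ Ideal.span {π ^ n}) →+* k)) := by
    refine ⟨n, ?_⟩
    have : RingHom.ker (r : (V ⧸ Ideal.span {π ^ n}) →+* k) ≤ Ideal.span {t} := fun s hs =>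
      Ideal.mem_span_singleton.mpr (hrker s hs)
    have := Ideal.pow_right_mono this n
    rw [Ideal.span_singleton_pow, htn, Ideal.span_singleton_zero] at this
    exact le_bot_iff.mp this
  have := Algebra.FormallySmooth.of_charZero_field ℂ k
  let σ : k →ₐ[ℂ] (V ⧸ Ideal.span {π ^ n}) :=
    Algebra.FormallySmooth.liftOfSurjective (AlgHom.id ℂ k) r hrsurj hnil
  have hσ : ∀ x, r (σ x) = x := fun x =>
    Algebra.FormallySmooth.liftOfSurjective_apply (AlgHom.id ℂ k) r hrsurj hnil x
  let : Algebra k (V ⧸ Ideal.span {π ^ n}) := σ.toRingHom.toAlgebra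
  have hσ' : ∀ x, r (algebraMap k _ x) = x := hσ
  have : IsScalarTower ℂ k (V ⧸ Ideal.span {π ^ n}) :=
    IsScalarTower.of_algebraMap_eq fun x => (σ.commutes x).symm
  have hraeval : ∀ f : k[X], r (aeval t f) = f.coeff 0 := by
    intro f
    induction f using Polynomial.induction_on' with
    | add p q hp hq => simp [hp, hq]
    | monomial m a =>
      rw [aeval_monomial, map_mul, hσ', map_pow, hrt, coeff_monomial]
      rcases m with _ | m <;> simp
  have hsurj : Function.Surjective (aeval (R := k) t) := by
    have : ∀ m s, ∃ (f : k[X]) (u : V ⧸ Ideal.span {π ^ n}), s = aeval t f + t ^ m * u := by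
      intro m
      induction m with
      | zero => exact fun s => ⟨0, s, by simp⟩
      | succ m ih =>
        intro s
        obtain ⟨f, u, rfl⟩ := ih s
        obtain ⟨w, hw⟩ := hrker (u - algebraMap k _ (r u)) (by rw [map_sub, hσ', sub_self])
        refine ⟨f + X ^ m * C (r u), w, ?_⟩
        rw [map_add, map_mul, map_pow, aeval_X, aeval_C, pow_succ, mul_assoc, ← hw]
        ring
    intro s
    obtain ⟨f, u, h⟩ := this n s
    exact ⟨f, by rw [h, htn, zero_mul, add_zero]⟩
  have hkerθ : ∀ f : k[X], aeval t f = 0 → X ^ n ∣ f := by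
    intro f hf
    have : ∀ m ≤ n, X ^ m ∣ f := by
      intro m
      induction m with
      | zero => simp
      | succ m ih =>
        intro hm
        obtain ⟨g, rfl⟩ := ih (by omega)
        rw [map_mul, map_pow, aeval_X] at hf
        rw [pow_succ]
        refine mul_dvd_mul_left _ (X_dvd_iff.mpr ?_)
        by_contra hg
        obtain ⟨v, hv⟩ := Ideal.Quotient.mk_surjective (aeval t g)
        have hvu : IsUnit v := by
          by_contra hv'
          have hmem : v ∈ IsLocalRing.maximalIdeal V := hv'
          rw [hπ.maximalIdeal_eq, ← hker, RingHom.mem_ker, ← hr, hv, hraeval] at hmem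
          exact hg hmem
        rw [← hv, ht, ← map_pow, ← map_mul, Ideal.Quotient.eq_zero_iff_mem,
          Ideal.mem_span_singleton, hvu.dvd_mul_right,
          pow_dvd_pow_iff hπ.ne_zero hπ.not_isUnit] at hf
        omega
    exact this n le_rfl
  obtain ⟨d', hd't, hd'⟩ := Derivation.exists_extend_of_ker_aeval t n hsurj htn hkerθ d
  refine ⟨d', fun s => ?_⟩
  obtain ⟨u, hu⟩ := hrker (s - algebraMap k _ (r s)) (by rw [map_sub, hσ', sub_self])
  rw [sub_eq_iff_eq_add] at hu
  generalize r s = x at hu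
  subst hu
  simp [hd't, hd', hrt, hσ']

end CoefficientField

/-- Torsion `p`-forms on a discrete valuation ring vanish on derivations of the residue field. -/
theorem detForm_eq_zero_of_smul_eq_zero_of_dvr {V : Type*} [CommRing V] [IsDomain V]
    [IsDiscreteValuationRing V] [Algebra ℂ V] {p : ℕ} (y : ⋀[V]^p (Ω[V⁄ℂ])) {s : V} (hs : s ≠ 0)
    (hy : s • y = 0)
    (d : Fin p → Derivation ℂ (IsLocalRing.ResidueField V) (IsLocalRing.ResidueField V)) :
    detForm (fun i => (d i).compAlgebraMap V) y = 0 := by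
  obtain ⟨π, hπ⟩ := IsDiscreteValuationRing.exists_irreducible V
  obtain ⟨m, u, rfl⟩ := IsDiscreteValuationRing.eq_unit_mul_pow_irreducible hs hπ
  let ρ : V →ₐ[ℂ] IsLocalRing.ResidueField V :=
    IsScalarTower.toAlgHom ℂ V (IsLocalRing.ResidueField V)
  have hker : RingHom.ker ρ = Ideal.span {π} := by
    rw [← hπ.maximalIdeal_eq]
    exact IsLocalRing.ker_residue
  let r : (V ⧸ Ideal.span {π ^ (m + 1)}) →ₐ[ℂ] IsLocalRing.ResidueField V :=
    Ideal.Quotient.liftₐ _ ρ fun a ha => by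
      rw [← RingHom.mem_ker, hker, Ideal.mem_span_singleton]
      exact (dvd_pow_self π m.succ_ne_zero).trans (Ideal.mem_span_singleton.mp ha)
  have hr : ∀ v, r (Ideal.Quotient.mk _ v) = ρ v := fun v => rfl
  choose d' hd' using fun i => Derivation.exists_lift_quotient_pow ρ
    IsLocalRing.residue_surjective hπ hker (m + 1) (d i) r hr
  let : Algebra (V ⧸ Ideal.span {π ^ (m + 1)}) (IsLocalRing.ResidueField V) :=
    r.toRingHom.toAlgebra
  have : IsScalarTower V (V ⧸ Ideal.span {π ^ (m + 1)}) (IsLocalRing.ResidueField V) :=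
    IsScalarTower.of_algebraMap_eq fun v => rfl
  rw [detForm_map (fun i => (d' i).compAlgebraMap V) (fun i => (d i).compAlgebraMap V)
    fun i a => (hd' i (Ideal.Quotient.mk _ a)).symm]
  have h0 := congrArg (detForm fun i => (d' i).compAlgebraMap V) hy
  rw [map_smul, map_zero] at h0
  obtain ⟨v, hv⟩ := Ideal.Quotient.mk_surjective (detForm (fun i => (d' i).compAlgebraMap V) y)
  rw [← hv] at h0 ⊢
  change Ideal.Quotient.mk _ (u * π ^ m * v) = 0 at h0
  rw [Ideal.Quotient.eq_zero_iff_mem, Ideal.mem_span_singleton, mul_assoc,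
    u.isUnit.dvd_mul_left, pow_succ, mul_dvd_mul_iff_left (pow_ne_zero _ hπ.ne_zero)] at h0
  change ρ v = 0
  rw [← RingHom.mem_ker, hker]
  exact Ideal.mem_span_singleton.mpr h0

/-- The normalization of an affine domain over a field of characteristic zero is Noetherian. -/
theorem exists_isIntegrallyClosed_extension.{u} (k : Type*) [Field k] [CharZero k] (C : Type u)
    [CommRing C] [IsDomain C] [Algebra k C] [Algebra.FiniteType k C] :
    ∃ (S : Type u) (_ : CommRing S) (_ : Algebra C S), IsDomain S ∧ IsNoetherianRing S ∧
      IsIntegrallyClosed S ∧ Algebra.IsIntegral C S ∧ Function.Injective (algebraMap C S) := by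
  obtain ⟨s, g, hg, hfin⟩ := exists_finite_inj_algHom_of_fg k C
  let P := MvPolynomial (Fin s) k
  let K := FractionRing C
  let : Algebra P C := g.toRingHom.toAlgebra
  have : Module.Finite P C := hfin
  have : FaithfulSMul P C := (faithfulSMul_iff_algebraMap_injective P C).mpr hg
  have : FaithfulSMul P K := FaithfulSMul.trans P C K
  let : Algebra (FractionRing P) K := FractionRing.liftAlgebra P K
  have : IsScalarTower P (FractionRing P) K := FractionRing.isScalarTower_liftAlgebra P K
  have : FiniteDimensional (FractionRing P) K := .of_isLocalization P C (nonZeroDivisors P)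
  have hK : IsIntegralClosure (integralClosure C K) P K :=
    { algebraMap_injective := Subtype.val_injective
      isIntegral_iff := fun {x} => ⟨fun hx => ⟨⟨x, hx.tower_top⟩, rfl⟩, by
        rintro ⟨y, rfl⟩
        exact isIntegral_trans (A := C) _ y.2⟩ }
  have : IsNoetherianRing (integralClosure C K) :=
    IsIntegralClosure.isNoetherianRing P (FractionRing P) K _
  have : IsIntegrallyClosed (integralClosure C K) :=
    integralClosure.isIntegrallyClosedOfFiniteExtension K
  exact ⟨integralClosure C K, inferInstance, inferInstance, inferInstance, inferInstance,
    inferInstance, inferInstance, FaithfulSMul.algebraMap_injective _ _⟩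

/-- The localization of a normal Noetherian domain at a height one prime is a discrete valuation
ring. -/
theorem Localization.AtPrime.isDiscreteValuationRing_of_isIntegrallyClosed {S : Type*} [CommRing S]
    [IsDomain S] [IsNoetherianRing S] [IsIntegrallyClosed S] (Q : Ideal S) [Q.IsPrime] (hQ : Q ≠ ⊥)
    (h : ∀ P : Ideal S, P.IsPrime → P ≠ ⊥ → P ≤ Q → P = Q) :
    IsDiscreteValuationRing (Localization.AtPrime Q) := by
  have : IsIntegrallyClosed (Localization.AtPrime Q) :=
    isIntegrallyClosed_of_isLocalization _ Q.primeCompl Q.primeCompl_le_nonZeroDivisors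
  have : IsPrincipalIdealRing (Localization.AtPrime Q) := by
    have tfae := (tfae_of_isNoetherianRing_of_isLocalRing_of_isDomain
      (Localization.AtPrime Q)).out 3 0
    refine tfae.mp ⟨this, fun P hP hP' => ?_⟩
    refine Localization.AtPrime.eq_maximalIdeal_iff_under_eq.mp (h _ inferInstance ?_ ?_)
    · intro h0
      apply hP
      rw [← IsLocalization.map_under Q.primeCompl _ P]
      rw [h0, Ideal.map_bot]
    · exact (Ideal.comap_mono (IsLocalRing.le_maximalIdeal hP'.ne_top)).trans
        (Localization.AtPrime.under_maximalIdeal (I := Q)).le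
  refine { not_a_field' := fun h0 => hQ ?_ }
  refine (Localization.AtPrime.under_maximalIdeal (I := Q)).symm.trans ?_
  rw [h0]
  exact Ideal.comap_bot_of_injective _
    (IsLocalization.injective _ Q.primeCompl_le_nonZeroDivisors)

/-- A height one prime of an affine domain is dominated by a discrete valuation ring. -/
theorem exists_isDiscreteValuationRing_comap_eq.{u} (k : Type*) [Field k] [CharZero k] {C : Type u}
    [CommRing C] [IsDomain C] [Algebra k C] [Algebra.FiniteType k C] (q : Ideal C) [q.IsPrime]
    (hq : q ≠ ⊥) (h : ∀ P : Ideal C, P.IsPrime → P ≠ ⊥ → P ≤ q → P = q) :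
    ∃ (V : Type u) (_ : CommRing V) (_ : IsDomain V) (_ : IsDiscreteValuationRing V)
      (_ : Algebra C V), Function.Injective (algebraMap C V) ∧
        (IsLocalRing.maximalIdeal V).comap (algebraMap C V) = q := by
  obtain ⟨S, _, _, _, _, _, _, hinj⟩ := exists_isIntegrallyClosed_extension k C
  have : FaithfulSMul C S := (faithfulSMul_iff_algebraMap_injective C S).mpr hinj
  obtain ⟨Q, _, _, hQ⟩ := Ideal.exists_ideal_over_prime_of_isIntegral q (⊥ : Ideal S)
    (by rw [Ideal.comap_bot_of_injective _ hinj]; exact bot_le)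
  have hQ0 : Q ≠ ⊥ := by
    rintro rfl
    rw [Ideal.comap_bot_of_injective _ hinj] at hQ
    exact hq hQ.symm
  have := Localization.AtPrime.isDiscreteValuationRing_of_isIntegrallyClosed Q hQ0
    fun P _ hP0 hPQ => by
      by_contra hne
      have h1 := Ideal.IsIntegral.comap_lt_comap (R := C) (lt_of_le_of_ne hPQ hne)
      rw [hQ] at h1
      refine h1.ne (h _ inferInstance ?_ h1.le)
      exact Ideal.IsIntegral.comap_ne_bot C hP0
  refine ⟨Localization.AtPrime Q, inferInstance, inferInstance, this, inferInstance, ?_, ?_⟩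
  · rw [IsScalarTower.algebraMap_eq C S]
    exact (IsLocalization.injective _ Q.primeCompl_le_nonZeroDivisors).comp hinj
  · rw [IsScalarTower.algebraMap_eq C S, ← Ideal.comap_comap]
    exact (congrArg _ (IsLocalization.AtPrime.under_maximalIdeal _ Q)).trans hQ

theorem Derivation.compAlgebraMap_compAlgebraMap {R C E κ : Type*} [CommRing R] [CommRing C]
    [CommRing E] [CommRing κ] [Algebra R C] [Algebra R E] [Algebra R κ] [Algebra C E] [Algebra C κ]
    [Algebra E κ] [IsScalarTower R C E] [IsScalarTower R C κ] [IsScalarTower R E κ]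
    [IsScalarTower C E κ] (d : Derivation R κ κ) :
    (d.compAlgebraMap E).compAlgebraMap C = d.compAlgebraMap C := by
  ext x
  simp only [Derivation.compAlgebraMap_apply, ← IsScalarTower.algebraMap_apply]

/-- A `p`-form on a domain `E` killed by all derivations of some extension field is torsion. -/
theorem exists_smul_eq_zero_of_forall_field {E κ : Type*} [CommRing E] [IsDomain E] [Field κ]
    [Algebra ℂ E] [Algebra ℂ κ] [Algebra E κ] [IsScalarTower ℂ E κ] [FaithfulSMul E κ] {p : ℕ}
    (w : ⋀[E]^p (Ω[E⁄ℂ]))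
    (hw : ∀ d : Fin p → Derivation ℂ κ κ, detForm (fun i => (d i).compAlgebraMap E) w = 0) :
    ∃ e : E, e ≠ 0 ∧ e • w = 0 := by
  let K := FractionRing E
  let : Algebra K κ := FractionRing.liftAlgebra E κ
  have : IsScalarTower E K κ := FractionRing.isScalarTower_liftAlgebra E κ
  have : IsScalarTower ℂ K κ := .to₁₃₄ ℂ E K κ
  have : CharZero K := charZero_of_injective_algebraMap (algebraMap ℂ K).injective
  obtain ⟨e, he, hew⟩ := exists_smul_eq_zero_of_detForm_eq_zero (K := K) (nonZeroDivisors E) w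
    fun d => by
      choose d' hd' using fun i => (d i).exists_extend (L := κ)
      refine (algebraMap K κ).injective ?_
      rw [map_zero, ← hw d']
      refine (detForm_map _ _ (fun i a => ?_) w).symm
      simp only [Derivation.compAlgebraMap_apply]
      rw [← hd', ← IsScalarTower.algebraMap_apply]
  exact ⟨e, nonZeroDivisors.ne_zero he, hew⟩

/-- Torsion `p`-forms on an affine domain restrict to torsion forms along a height one prime. -/
theorem exists_smul_formPullback_eq_zero_of_minimal.{u} {C : Type u} {E : Type*} [CommRing C]
    [IsDomain C] [CommRing E] [IsDomain E] [Algebra ℂ C] [Algebra.FiniteType ℂ C] [Algebra ℂ E]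
    [Algebra C E] [IsScalarTower ℂ C E] (hsurj : Function.Surjective (algebraMap C E))
    (hker : RingHom.ker (algebraMap C E) ≠ ⊥)
    (hmin : ∀ P : Ideal C, P.IsPrime → P ≠ ⊥ → P ≤ RingHom.ker (algebraMap C E) →
      P = RingHom.ker (algebraMap C E))
    {p : ℕ} (z : ⋀[C]^p (Ω[C⁄ℂ])) {c : C} (hc : c ≠ 0) (hz : c • z = 0) :
    ∃ e : E, e ≠ 0 ∧ e • formPullback ℂ C E p z = 0 := by
  have := RingHom.ker_isPrime (algebraMap C E)
  obtain ⟨V, _, _, _, _, hinj, hV⟩ := exists_isDiscreteValuationRing_comap_eq ℂ _ hker hmin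
  let : Algebra ℂ V := ((algebraMap C V).comp (algebraMap ℂ C)).toAlgebra
  have : IsScalarTower ℂ C V := .of_algebraMap_eq fun _ => rfl
  let κ := IsLocalRing.ResidueField V
  have hkerκ : RingHom.ker (algebraMap C κ) = RingHom.ker (algebraMap C E) := by
    rw [← hV, ← IsLocalRing.ker_residue, RingHom.comap_ker]
    rfl
  let : Algebra E κ := ((algebraMap C E).liftOfSurjective hsurj
    ⟨algebraMap C κ, hkerκ.ge⟩).toAlgebra
  have : IsScalarTower C E κ := .of_algebraMap_eq fun x =>
    ((algebraMap C E).liftOfRightInverse_comp_apply _ _ ⟨algebraMap C κ, hkerκ.ge⟩ x).symm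
  have : IsScalarTower ℂ E κ := .to₁₃₄ ℂ C E κ
  have : FaithfulSMul E κ := by
    rw [faithfulSMul_iff_algebraMap_injective, injective_iff_map_eq_zero]
    intro e he
    obtain ⟨x, rfl⟩ := hsurj e
    rwa [← IsScalarTower.algebraMap_apply, ← RingHom.mem_ker, hkerκ, RingHom.mem_ker] at he
  refine exists_smul_eq_zero_of_forall_field (κ := κ) _ fun d => ?_
  rw [detForm_formPullback (fun i => (d i).compAlgebraMap E)]
  simp only [Derivation.compAlgebraMap_compAlgebraMap]
  have := detForm_eq_zero_of_smul_eq_zero_of_dvr (formPullback ℂ C V p z)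
    (s := algebraMap C V c) ((map_ne_zero_iff _ hinj).mpr hc)
    (by rw [algebraMap_smul, ← map_smul, hz, map_zero]) d
  rw [detForm_formPullback (fun i => (d i).compAlgebraMap V)] at this
  simpa only [Derivation.compAlgebraMap_compAlgebraMap] using this

/-- Torsion `p`-forms restrict to torsion forms along every prime. -/
theorem exists_smul_formPullback_quotient_eq_zero {B : Type*} [CommRing B] [Algebra ℂ B]
    [Algebra.FiniteType ℂ B] {p : ℕ} {x : ⋀[B]^p (Ω[B⁄ℂ])} {b : B} (hb : b ∈ nonZeroDivisors B)
    (hx : b • x = 0) (q : Ideal B) [hq : q.IsPrime] :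
    ∃ e : B ⧸ q, e ≠ 0 ∧ e • formPullback ℂ B (B ⧸ q) p x = 0 := by
  have : IsNoetherianRing B := Algebra.FiniteType.isNoetherianRing ℂ B
  induction h : q.height using WellFoundedLT.induction generalizing q with
  | ind n ih =>
  subst h
  by_cases hmin : q ∈ minimalPrimes B
  · refine ⟨Ideal.Quotient.mk q b, ?_, ?_⟩
    · rw [Ne, Ideal.Quotient.eq_zero_iff_mem]
      exact fun h => notMem_nonZeroDivisors_of_mem_mem_minimalPrimes h hmin hb
    · change algebraMap B (B ⧸ q) b • _ = _
      rw [algebraMap_smul, ← map_smul, hx, map_zero]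
  · have hne : {P : Ideal B | P.IsPrime ∧ P < q}.Nonempty := by
      obtain ⟨P, hP, hPq⟩ := Ideal.exists_minimalPrimes_le (bot_le : ⊥ ≤ q)
      exact ⟨P, hP.1.1, lt_of_le_of_ne hPq fun h => hmin (h ▸ hP)⟩
    obtain ⟨P, ⟨hP, hPq⟩, hmax⟩ := wellFounded_gt.has_min _ hne
    obtain ⟨c, hc, hcx⟩ := ih _ (Ideal.height_strict_mono_of_isPrime_of_isPrime hPq) P rfl
    let : Algebra (B ⧸ P) (B ⧸ q) := (Ideal.Quotient.factor hPq.le).toAlgebra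
    have : IsScalarTower B (B ⧸ P) (B ⧸ q) := .of_algebraMap_eq fun _ => rfl
    have : IsScalarTower ℂ (B ⧸ P) (B ⧸ q) := .of_algebraMap_eq fun _ => rfl
    have hker : (RingHom.ker (algebraMap (B ⧸ P) (B ⧸ q))).comap (Ideal.Quotient.mk P) = q := by
      rw [RingHom.comap_ker]
      exact Ideal.mk_ker
    obtain ⟨e, he, hex⟩ := exists_smul_formPullback_eq_zero_of_minimal (E := B ⧸ q)
      (Ideal.Quotient.factor_surjective hPq.le)
      (fun h => by
        rw [h, ← RingHom.ker_eq_comap_bot, Ideal.mk_ker] at hker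
        exact hPq.ne hker)
      (fun Q hQ hQ0 hQq => by
        refine Ideal.comap_injective_of_surjective _ Ideal.Quotient.mk_surjective ?_
        rw [hker]
        by_contra hne
        refine hmax (Q.comap (Ideal.Quotient.mk P)) ⟨inferInstance,
          lt_of_le_of_ne (hker ▸ Ideal.comap_mono hQq) hne⟩ (lt_of_le_of_ne ?_ fun h => ?_)
        · exact Ideal.mk_ker.symm.le.trans (Ideal.comap_mono bot_le)
        · refine hQ0 (Ideal.comap_injective_of_surjective _ Ideal.Quotient.mk_surjective ?_)
          rw [← h, ← RingHom.ker_eq_comap_bot, Ideal.mk_ker])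
      (formPullback ℂ B (B ⧸ P) p x) hc hcx
    rw [formPullback_comp] at hex
    exact ⟨e, he, hex⟩

theorem exists_smul_eq_zero_of_mem_minimalPrimes {B A : Type*} [CommRing B] [CommRing A]
    [Algebra ℂ B] [Algebra.FiniteType ℂ B] [Algebra ℂ A] [IsReduced A] [Algebra B A]
    [IsScalarTower ℂ B A] {p : ℕ} {x : ⋀[B]^p (Ω[B⁄ℂ])} {b : B} (hb : b ∈ nonZeroDivisors B)
    (hx : b • x = 0) (P : Ideal A) (hP : P ∈ minimalPrimes A) :
    ∃ a ∉ P, a • formPullback ℂ B A p x = 0 := by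
  have := hP.1.1
  let K := Localization.AtPrime P
  have : Ring.KrullDimLE 0 K := .of_isLocalization P hP K
  let : Field K := Ring.KrullDimLE.isField_of_isReduced.toField
  let q := P.comap (algebraMap B A)
  obtain ⟨c, hc, hcx⟩ := exists_smul_formPullback_quotient_eq_zero hb hx q
  have hq : RingHom.ker (algebraMap B K) = q := by
    rw [IsScalarTower.algebraMap_eq B A K, ← RingHom.comap_ker, RingHom.ker_eq_comap_bot,
      ← IsLocalRing.isField_iff_maximalIdeal_eq.mp (Field.toIsField K)]
    exact congrArg _ (Localization.AtPrime.under_maximalIdeal (I := P))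
  let : Algebra (B ⧸ q) K := (Ideal.Quotient.lift q (algebraMap B K) fun a ha => by
    rwa [← hq] at ha).toAlgebra
  have : IsScalarTower B (B ⧸ q) K := .of_algebraMap_eq fun _ => rfl
  have : IsScalarTower ℂ (B ⧸ q) K :=
    .of_algebraMap_eq fun r => IsScalarTower.algebraMap_apply ℂ B K r
  have hc' : algebraMap (B ⧸ q) K c ≠ 0 := by
    obtain ⟨c, rfl⟩ := Ideal.Quotient.mk_surjective c
    intro h
    rw [Ne, Ideal.Quotient.eq_zero_iff_mem, ← hq] at hc
    exact hc h
  refine exists_smul_eq_zero_of_detForm_eq_zero (K := K) P.primeCompl _ fun d => ?_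
  rw [detForm_formPullback (fun i => (d i).compAlgebraMap A)]
  have := congrArg (detForm fun i => (d i).compAlgebraMap (B ⧸ q)) hcx
  rw [map_smul, map_zero, Algebra.smul_def, mul_eq_zero, or_iff_right hc',
    detForm_formPullback (fun i => (d i).compAlgebraMap (B ⧸ q))] at this
  exact this

/-- In a reduced Noetherian ring, an ideal contained in no minimal prime contains a
non-zerodivisor. -/
theorem exists_mem_nonZeroDivisors_of_forall_minimalPrimes {A : Type*} [CommRing A]
    [IsNoetherianRing A] [IsReduced A] (I : Ideal A)
    (h : ∀ P ∈ minimalPrimes A, ∃ a ∈ I, a ∉ P) :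
    ∃ a ∈ I, a ∈ nonZeroDivisors A := by
  by_contra! hcon
  obtain ⟨P, hP, hIP⟩ := (I.subset_union_prime_finite
    (minimalPrimes.finite_of_isNoetherianRing A) (f := id) 0 0 fun _ h _ _ => h.1.1).1 <| by
      intro a ha
      have hza := hcon a ha
      simp only [mem_nonZeroDivisors_iff_right, not_forall] at hza
      obtain ⟨y, hy, hy0⟩ := hza
      have hy' : y ∉ sInf (minimalPrimes A) := by
        rw [minimalPrimes, Ideal.sInf_minimalPrimes]
        change y ∉ nilradical A
        rwa [nilradical_eq_zero, Ideal.zero_eq_bot, Ideal.mem_bot]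
      simp only [Ideal.mem_sInf, not_forall] at hy'
      obtain ⟨P, hP, hyP⟩ := hy'
      refine Set.mem_biUnion hP ((hP.1.1.mem_or_mem (?_ : y * a ∈ P)).resolve_left hyP)
      rw [hy]
      exact P.zero_mem
  obtain ⟨a, ha, haP⟩ := h P hP
  exact haP (hIP ha)

/-- Affine form of Proposition 2.4 for `p`-forms: the induced map on `p`-th
exterior powers of Kähler differentials maps torsion into torsion.  The
ℂ-algebra homomorphism `φ : B → A` is encoded by `Algebra B A` with
`IsScalarTower ℂ B A`; "B-linear with target viewed as B-module via φ" is
expressed as semilinearity over `algebraMap B A`, and the wedge condition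
`L((db₁)∧⋯∧(db_p)) = (dφ(b₁))∧⋯∧(dφ(b_p))` is expressed through the
alternating maps `ExteriorAlgebra.ιMulti`. -/
theorem pullback_of_torsion_p_forms_is_torsion
    (B A : Type*) [CommRing B] [CommRing A]
    [Algebra ℂ B] [Algebra ℂ A] [IsReduced B] [IsReduced A]
    [Algebra.FiniteType ℂ B] [Algebra.FiniteType ℂ A]
    [Algebra B A] [IsScalarTower ℂ B A]
    (p : ℕ) (hp : 1 ≤ p)
    (L : ⋀[B]^p (Ω[B⁄ℂ]) →ₛₗ[algebraMap B A] ⋀[A]^p (Ω[A⁄ℂ]))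
    (hL : ∀ (b : Fin p → B) (x : ⋀[B]^p (Ω[B⁄ℂ])),
      (x : ExteriorAlgebra B (Ω[B⁄ℂ])) =
          ExteriorAlgebra.ιMulti B p (fun i => KaehlerDifferential.D ℂ B (b i)) →
        (L x : ExteriorAlgebra A (Ω[A⁄ℂ])) =
          ExteriorAlgebra.ιMulti A p
            (fun i => KaehlerDifferential.D ℂ A (algebraMap B A (b i)))) :
    ∀ x ∈ Submodule.torsion B (⋀[B]^p (Ω[B⁄ℂ])),
      L x ∈ Submodule.torsion A (⋀[A]^p (Ω[A⁄ℂ])) := by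
  intro x hx
  obtain ⟨⟨b, hb⟩, hbx⟩ := hx
  have : IsNoetherianRing A := Algebra.FiniteType.isNoetherianRing ℂ A
  rw [semilinear_eq_formPullback p L hL]
  obtain ⟨a, ha, ha'⟩ := exists_mem_nonZeroDivisors_of_forall_minimalPrimes
    (LinearMap.ker (LinearMap.toSpanSingleton A _ (formPullback ℂ B A p x))) fun P hP => by
      obtain ⟨a, haP, hax⟩ := exists_smul_eq_zero_of_mem_minimalPrimes (A := A) hb hbx P hP
      exact ⟨a, hax, haP⟩
  exact ⟨⟨a, ha'⟩, ha⟩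
end

section
/- Let B and A be reduced commutative ℂ-algebras of finite type and let φ : B → A be a ℂ-algebra homomorphism, with induced map dφ : Ω_{B/ℂ} → Ω_{A/ℂ}. Write tor Ω_{B/ℂ} and tor Ω_{A/ℂ} for the torsion submodules, and β_B : Ω_{B/ℂ} → Ω_{B/ℂ}/tor, β_A : Ω_{A/ℂ} → Ω_{A/ℂ}/tor for the quotient maps. Then dφ maps tor Ω_{B/ℂ} into tor Ω_{A/ℂ}, and there exists a unique B-linear map d̄φ : Ω_{B/ℂ}/tor → Ω_{A/ℂ}/tor (the target viewed as a B-module via φ) such that d̄φ ∘ β_B = β_A ∘ dφ. (Affine form of Corollary 2.7: pull-back for torsion-free differentials, p = 1.) -/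
section

open KaehlerDifferential IsLocalRing Polynomial

theorem KaehlerDifferential.map_map_apply (k A B C : Type*) [CommRing k] [CommRing A] [CommRing B]
    [CommRing C] [Algebra k A] [Algebra k B] [Algebra k C] [Algebra A B] [Algebra A C]
    [Algebra B C] [IsScalarTower k A B] [IsScalarTower k A C] [IsScalarTower k B C]
    [IsScalarTower A B C] (ω : Ω[A⁄k]) :
    map k k B C (map k k A B ω) = map k k A C ω := by
  have h : ω ∈ Submodule.span A (Set.range (D k A)) := by simp [span_range_derivation]
  induction h using Submodule.span_induction with
  | mem x h =>
    obtain ⟨a, rfl⟩ := h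
    simp [map_D, ← IsScalarTower.algebraMap_apply]
  | zero => simp
  | add x y _ _ hx hy => simp [hx, hy]
  | smul a x _ hx => simp [hx]

theorem KaehlerDifferential.algebraMap_smul_map (k A B : Type*) [CommRing k] [CommRing A]
    [CommRing B] [Algebra k A] [Algebra k B] [Algebra A B] [IsScalarTower k A B] (a : A)
    (ω : Ω[A⁄k]) : algebraMap A B a • map k k A B ω = map k k A B (a • ω) := by
  rw [algebraMap_smul, LinearMap.map_smul]

theorem KaehlerDifferential.map_injective_of_formallySmooth (k K L : Type*) [CommRing k] [Field K]
    [Field L] [Algebra k K] [Algebra k L] [Algebra K L] [IsScalarTower k K L]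
    [Algebra.FormallySmooth K L] : Function.Injective (map k k K L) := by
  have h : Function.Injective (mapBaseChange k K L) := by
    rw [injective_iff_map_eq_zero]
    intro x hx
    obtain ⟨y, rfl⟩ := (Algebra.H1Cotangent.exact_δ_mapBaseChange k K L x).mp hx
    rw [Subsingleton.elim y 0, map_zero]
  intro x y hxy
  apply (Module.FaithfullyFlat.tensorProduct_mk_injective (A := K) (B := L) (Ω[K⁄k]))
  apply h
  simpa using hxy

theorem KaehlerDifferential.map_residueField_eq_zero_of_smul_eq_zero {k V : Type*} [CommRing k]
    [CommRing V] [IsDomain V] [IsDiscreteValuationRing V] [Algebra k V]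
    [Algebra.FormallySmooth k (ResidueField V)] {f : V} (hf : f ≠ 0) {ω : Ω[V⁄k]}
    (h : f • ω = 0) : map k k V (ResidueField V) ω = 0 := by
  obtain ⟨t, ht⟩ := IsDiscreteValuationRing.exists_irreducible V
  obtain ⟨n, u, rfl⟩ := IsDiscreteValuationRing.eq_unit_mul_pow_irreducible hf ht
  have hm : maximalIdeal V = Ideal.span {t} := ht.maximalIdeal_eq
  have htω : t ^ n • ω = 0 := by
    rw [mul_smul] at h
    simpa using congrArg ((↑u⁻¹ : V) • ·) h
  set L := ResidueField V
  let I : Ideal V := Ideal.span {t ^ (n + 1)}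
  have hI : ∀ v, v ∈ I → residue V v = 0 := fun v hv ↦ by
    rw [residue_eq_zero_iff, hm, Ideal.mem_span_singleton]
    exact (dvd_pow_self t n.succ_ne_zero).trans (Ideal.mem_span_singleton.mp hv)
  let W := V ⧸ I
  let ρ : W →ₐ[k] L := Ideal.Quotient.liftₐ I (IsScalarTower.toAlgHom k V L) hI
  have hρ_mk (v : V) : ρ (Ideal.Quotient.mk I v) = residue V v := rfl
  have hρ : Function.Surjective ρ := fun x ↦ by
    obtain ⟨v, rfl⟩ := residue_surjective x
    exact ⟨Ideal.Quotient.mk I v, rfl⟩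
  let τ : W := Ideal.Quotient.mk I t
  have hρ_ker {w : W} (hw : ρ w = 0) : τ ∣ w := by
    obtain ⟨v, rfl⟩ := Ideal.Quotient.mk_surjective w
    rw [hρ_mk, residue_eq_zero_iff, hm, Ideal.mem_span_singleton] at hw
    exact map_dvd _ hw
  have hτ : τ ^ (n + 1) = 0 := by
    rw [← map_pow]
    exact Ideal.Quotient.eq_zero_iff_mem.mpr (Ideal.mem_span_singleton_self _)
  have hτ' : τ ^ n ≠ 0 := by
    rw [← map_pow, Ne, Ideal.Quotient.eq_zero_iff_mem, Ideal.mem_span_singleton,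
      pow_dvd_pow_iff ht.ne_zero ht.not_isUnit]
    lia
  have hρτ : ρ τ = 0 := by
    rw [hρ_mk, residue_eq_zero_iff, hm]; exact Ideal.mem_span_singleton_self t
  have hnil : IsNilpotent (RingHom.ker (ρ : W →+* L)) := by
    refine ⟨n + 1, ?_⟩
    have : RingHom.ker (ρ : W →+* L) ≤ Ideal.span {τ} := fun w hw ↦
      Ideal.mem_span_singleton.mpr (hρ_ker hw)
    refine le_bot_iff.mp ((Ideal.pow_right_mono this _).trans ?_)
    rw [Ideal.span_singleton_pow, hτ, Ideal.span_singleton_eq_bot.mpr rfl]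
  let σ : L →ₐ[k] W := Algebra.FormallySmooth.liftOfSurjective (AlgHom.id k L) ρ hρ hnil
  have hσ (x : L) : ρ (σ x) = x :=
    Algebra.FormallySmooth.liftOfSurjective_apply (AlgHom.id k L) ρ hρ hnil x
  have hunit {w : W} (hw : ρ w ≠ 0) : IsUnit w := by
    obtain ⟨v, rfl⟩ := Ideal.Quotient.mk_surjective w
    exact ((residue_ne_zero_iff_isUnit v).mp hw).map _
  let π : L[X] →ₐ[k] W :=
    { eval₂RingHom (σ : L →+* W) τ with
      commutes' := fun r ↦ by simp [Polynomial.algebraMap_apply] }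
  have hπ (p : L[X]) : π p = p.eval₂ (σ : L →+* W) τ := rfl
  have hπX : π X = τ := by simp [hπ]
  have hρπ (p : L[X]) : ρ (π p) = p.coeff 0 := by
    have h : (ρ : W →+* L).comp (σ : L →+* W) = RingHom.id L := RingHom.ext hσ
    rw [hπ, ← AlgHom.coe_toRingHom ρ, Polynomial.hom_eval₂, h, AlgHom.coe_toRingHom, hρτ,
      coeff_zero_eq_eval_zero, ← eval₂_id]
  have hπ_surj : Function.Surjective π := by
    have key (m : ℕ) (w : W) : ∃ p, τ ^ m ∣ w - π p := by
      induction m with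
      | zero => exact ⟨0, by simp⟩
      | succ m ih =>
        obtain ⟨p, c, hc⟩ := ih
        obtain ⟨d, hd⟩ := hρ_ker (w := c - σ (ρ c)) (by simp [hσ])
        refine ⟨p + C (ρ c) * X ^ m, d, ?_⟩
        have h1 : π (C (ρ c)) = σ (ρ c) := by simp [hπ]
        rw [map_add, map_mul, map_pow, hπX, h1]
        linear_combination hc + τ ^ m * hd
    intro w
    obtain ⟨p, hp⟩ := key (n + 1) w
    rw [hτ, zero_dvd_iff, sub_eq_zero] at hp
    exact ⟨p, hp.symm⟩
  have hπ_ker {p : L[X]} (hp : π p = 0) : X ^ (n + 1) ∣ p := by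
    by_cases hp0 : p = 0
    · simp [hp0]
    obtain ⟨q, hq, hq'⟩ := exists_eq_pow_rootMultiplicity_mul_and_not_dvd p hp0 0
    set m := p.rootMultiplicity 0
    rw [C_0, sub_zero] at hq hq'
    rw [hq, map_mul, map_pow, hπX] at hp
    have : IsUnit (π q) := hunit (by rwa [hρπ, Ne, ← X_dvd_iff])
    rw [this.mul_left_eq_zero] at hp
    rw [hq]
    refine Dvd.dvd.mul_right (pow_dvd_pow X ?_) q
    by_contra! hlt
    exact hτ' (pow_eq_zero_of_le (by lia) hp)
  rw [← Module.forall_dual_apply_eq_zero_iff L]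
  intro l
  let δ : Derivation k L L := l.compDer (D k L)
  let Δ : Derivation k L[X] L[X] :=
    (PolynomialModule.equivPolynomialSelf (R := L)).toLinearMap.compDer δ.mapCoeffs
  have hΔ (p : L[X]) (i : ℕ) : (Δ p).coeff i = δ (p.coeff i) := rfl
  have hΔker (p : L[X]) (hp : π p = 0) : π (Δ p) = 0 := by
    have : X ^ (n + 1) ∣ Δ p := by
      have := X_pow_dvd_iff.mp (hπ_ker hp)
      exact X_pow_dvd_iff.mpr fun d hd ↦ by rw [hΔ, this d hd, map_zero]
    obtain ⟨q, hq⟩ := this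
    rw [hq, map_mul, map_pow, hπX, hτ, zero_mul]
  let E : Derivation k W W := Derivation.liftOfSurjective hπ_surj hΔker
  have hE (p : L[X]) : E (π p) = π (Δ p) := Derivation.liftOfSurjective_apply hπ_surj hΔker p
  let e : Ω[V⁄k] →ₗ[V] W := (E.compAlgebraMap V).liftKaehlerDifferential
  have he (v : V) : e (D k V v) = E (Ideal.Quotient.mk I v) :=
    Derivation.liftKaehlerDifferential_comp_D _ _
  have hcomp (η : Ω[V⁄k]) : ρ (e η) = l (map k k V L η) := by
    have h : η ∈ Submodule.span V (Set.range (D k V)) := by simp [span_range_derivation]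
    induction h using Submodule.span_induction with
    | mem x h =>
      obtain ⟨v, rfl⟩ := h
      obtain ⟨p, hp⟩ := hπ_surj (Ideal.Quotient.mk I v)
      rw [he, ← hp, hE, hρπ, hΔ, ← hρπ, hp, hρ_mk, map_D]
      rfl
    | zero => simp
    | add x y _ _ hx hy => simp [hx, hy]
    | smul a x _ hx =>
      rw [e.map_smul, LinearMap.map_smul, Algebra.smul_def, map_mul, hx, ← algebraMap_smul L a,
        l.map_smul, smul_eq_mul]
      rfl
  rw [← hcomp]
  have h0 : τ ^ n * e ω = 0 := by
    rw [← map_pow]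
    have := congrArg e htω
    rwa [map_smul, map_zero, Algebra.smul_def] at this
  by_contra hne
  exact hτ' ((hunit hne).mul_left_eq_zero.mp h0)

theorem Algebra.FiniteType.finite_integralClosure (k C K : Type*) [Field k] [CharZero k]
    [CommRing C] [IsDomain C] [Field K] [Algebra k C] [Algebra C K] [IsFractionRing C K]
    [Algebra.FiniteType k C] : Module.Finite C (integralClosure C K) := by
  obtain ⟨s, g, hg, hfin⟩ := exists_finite_inj_algHom_of_fg k C
  algebraize [g.toRingHom]
  let P := MvPolynomial (Fin s) k
  have : Module.Finite P C := hfin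
  have : FaithfulSMul P C := (faithfulSMul_iff_algebraMap_injective P C).mpr hg
  let F := FractionRing P
  algebraize [(algebraMap C K).comp (algebraMap P C)]
  have : FaithfulSMul P K := .trans P C K
  let : Algebra F K := FractionRing.liftAlgebra P K
  have : Module.Finite F K := .of_isLocalization P C (nonZeroDivisors P)
  have : IsIntegralClosure (integralClosure C K) P K :=
    ⟨Subtype.val_injective, fun {x} ↦ ⟨fun h ↦ ⟨⟨x, h.tower_top⟩, rfl⟩, by
      rintro ⟨y, rfl⟩
      exact isIntegral_trans _ y.2⟩⟩
  have : Module.Finite P (integralClosure C K) := IsIntegralClosure.finite P F K _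
  exact .of_restrictScalars_finite P C _

theorem IsDiscreteValuationRing.localization_atPrime_of_mem_minimalPrimes_span_singleton
    {N : Type*} [CommRing N] [IsDomain N] [IsNoetherianRing N] [IsIntegrallyClosed N] {x : N}
    (hx : x ≠ 0) {P : Ideal N} [P.IsPrime] (hP : P ∈ (Ideal.span {x}).minimalPrimes) :
    IsDiscreteValuationRing (Localization.AtPrime P) := by
  have hP0 : P ≠ ⊥ := by
    rintro rfl
    exact hx (by simpa using hP.1.2)
  have hnf := IsLocalization.AtPrime.not_isField N hP0 (Localization.AtPrime P)
  have hic : IsIntegrallyClosed (Localization.AtPrime P) :=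
    isIntegrallyClosed_of_isLocalization _ P.primeCompl P.primeCompl_le_nonZeroDivisors
  have : Ring.KrullDimLE 1 (Localization.AtPrime P) := by
    rw [Ring.krullDimLE_iff, IsLocalization.AtPrime.ringKrullDim_eq_height P]
    exact_mod_cast Ideal.height_le_one_of_isPrincipal_of_mem_minimalPrimes _ P hP
  have hiff : IsDiscreteValuationRing (Localization.AtPrime P) ↔ _ :=
    (IsDiscreteValuationRing.TFAE _ hnf).out 0 3
  refine hiff.mpr ⟨hic, IsLocalRing.maximalIdeal _, ⟨?_, inferInstance⟩, ?_⟩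
  · exact isField_iff_maximalIdeal_eq.not.mp hnf
  · rintro Q ⟨hQ, hQ'⟩
    exact eq_maximalIdeal (hQ'.isMaximal_of_ne_bot hQ)

theorem KaehlerDifferential.map_eq_zero_of_ker_algebraMap_eq {k C F L : Type*} [Field k]
    [CharZero k] [CommRing C] [CommRing F] [Field L] [Algebra k C] [Algebra k F] [Algebra k L]
    [Algebra C F] [Algebra C L] [IsScalarTower k C F] [IsScalarTower k C L]
    [Algebra.EssFiniteType k L] (hF : IsField F)
    (hker : RingHom.ker (algebraMap C L) = RingHom.ker (algebraMap C F)) {ω : Ω[C⁄k]}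
    (h : map k k C L ω = 0) : map k k C F ω = 0 := by
  obtain ⟨q, hq⟩ : ∃ q, q = RingHom.ker (algebraMap C L) := ⟨_, rfl⟩
  have hqF : q = RingHom.ker (algebraMap C F) := hq.trans hker
  have : q.IsPrime := hq ▸ RingHom.ker_isPrime _
  let fL : q.ResidueField →+* L := Ideal.ResidueField.lift q (algebraMap C L) hq.le
    fun x hx ↦ isUnit_iff_ne_zero.mpr fun h ↦ hx (by rw [hq]; exact h)
  let fF : q.ResidueField →+* F := Ideal.ResidueField.lift q (algebraMap C F) hqF.le
    fun x hx ↦ by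
      obtain ⟨y, hy⟩ := hF.mul_inv_cancel (a := algebraMap C F x) fun h ↦ hx (by rw [hqF]; exact h)
      exact .of_mul_eq_one _ hy
  algebraize [fL, fF]
  have : IsScalarTower C q.ResidueField L := .of_algebraMap_eq fun x ↦
    (Ideal.ResidueField.lift_algebraMap q _ _ _ x).symm
  have : IsScalarTower C q.ResidueField F := .of_algebraMap_eq fun x ↦
    (Ideal.ResidueField.lift_algebraMap q _ _ _ x).symm
  have : IsScalarTower k q.ResidueField L := .to₁₃₄ k C q.ResidueField L
  have : IsScalarTower k q.ResidueField F := .to₁₃₄ k C q.ResidueField F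
  have : CharZero q.ResidueField := charZero_of_injective_algebraMap (algebraMap k _).injective
  have : Algebra.EssFiniteType q.ResidueField L := .of_comp k _ _
  have h0 : map k k C q.ResidueField ω = 0 := by
    apply map_injective_of_formallySmooth k q.ResidueField L
    rw [map_map_apply, h, map_zero]
  rw [← map_map_apply k C q.ResidueField F, h0, map_zero]

theorem KaehlerDifferential.map_eq_zero_of_ker_mem_minimalPrimes {k C K F : Type*} [Field k]
    [CharZero k] [CommRing C] [IsDomain C] [Field K] [Field F] [Algebra k C] [Algebra k K]
    [Algebra k F] [Algebra C K] [Algebra C F] [IsScalarTower k C K] [IsScalarTower k C F]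
    [IsFractionRing C K] [Algebra.FiniteType k C] {x : C} (hx : x ≠ 0)
    (hmin : RingHom.ker (algebraMap C F) ∈ (Ideal.span {x}).minimalPrimes) {ω : Ω[C⁄k]}
    (h : map k k C K ω = 0) : map k k C F ω = 0 := by
  have := Algebra.FiniteType.finite_integralClosure k C K
  let N := integralClosure C K
  obtain ⟨q, hq⟩ : ∃ q, q = RingHom.ker (algebraMap C F) := ⟨_, rfl⟩
  have : q.IsPrime := hq ▸ RingHom.ker_isPrime _
  have hinj : Function.Injective (algebraMap C N) :=
    FaithfulSMul.algebraMap_injective C N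
  obtain ⟨Q, hQ, hQq⟩ := Ideal.exists_ideal_over_prime_of_isIntegral_of_isDomain (S := N) q
    (by rw [(RingHom.injective_iff_ker_eq_bot _).mp hinj]; exact bot_le)
  have hxq : x ∈ q := hq ▸ hmin.1.2 (Ideal.mem_span_singleton_self x)
  obtain ⟨P, hP, hPQ⟩ := Ideal.exists_minimalPrimes_le (I := Ideal.span {algebraMap C N x}) (J := Q)
    (by rw [Ideal.span_singleton_le_iff_mem, ← Ideal.mem_comap, hQq]; exact hxq)
  have : P.IsPrime := hP.1.1
  have hPq : P.comap (algebraMap C N) = q := by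
    refine le_antisymm ((Ideal.comap_mono hPQ).trans hQq.le) ?_
    refine hq ▸ hmin.2 ⟨inferInstance, ?_⟩ (hq ▸ (Ideal.comap_mono hPQ).trans hQq.le)
    rw [Ideal.span_singleton_le_iff_mem]
    exact hP.1.2 (Ideal.mem_span_singleton_self _)
  have : Algebra.FiniteType k N := .trans ‹Algebra.FiniteType k C› inferInstance
  have : IsNoetherianRing N := Algebra.FiniteType.isNoetherianRing k N
  have : IsFractionRing N K := integralClosure.isFractionRing_of_finite_extension K K
  have : IsIntegrallyClosed N := integralClosure.isIntegrallyClosedOfFiniteExtension K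
  let V := Localization.AtPrime P
  have : IsDiscreteValuationRing V :=
    IsDiscreteValuationRing.localization_atPrime_of_mem_minimalPrimes_span_singleton
      (by simpa using hinj.ne hx) hP
  have : Algebra.EssFiniteType k P.ResidueField := .comp k N _
  refine map_eq_zero_of_ker_algebraMap_eq (L := P.ResidueField) (Field.toIsField F) ?_ ?_
  · rw [← hq, ← hPq, IsScalarTower.algebraMap_eq C N P.ResidueField, ← RingHom.comap_ker,
      Ideal.ker_algebraMap_residueField]
  obtain ⟨s, hs⟩ : ∃ s : nonZeroDivisors N, s • map k k C N ω = 0 := by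
    rw [← IsLocalizedModule.eq_zero_iff (nonZeroDivisors N) (map k k N K), map_map_apply, h]
  have hV : algebraMap N V s • map k k N V (map k k C N ω) = 0 := by
    rw [algebraMap_smul_map]
    exact (congrArg (map k k N V) hs).trans (map_zero _)
  have hs0 : algebraMap N V s ≠ 0 := by
    rw [Ne, FaithfulSMul.algebraMap_eq_zero_iff]
    exact nonZeroDivisors.coe_ne_zero s
  have := map_residueField_eq_zero_of_smul_eq_zero hs0 hV
  rw [← map_map_apply k C N P.ResidueField, ← map_map_apply k N V P.ResidueField]
  exact this

theorem KaehlerDifferential.map_residueField_eq_zero_of_mem_torsion {k B : Type*} [Field k]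
    [CharZero k] [CommRing B] [Algebra k B] [Algebra.FiniteType k B] {ω : Ω[B⁄k]}
    (hω : ω ∈ Submodule.torsion B (Ω[B⁄k])) (q : Ideal B) [q.IsPrime] :
    map k k B q.ResidueField ω = 0 := by
  have : IsNoetherianRing B := Algebra.FiniteType.isNoetherianRing k B
  let S : Set (Ideal B) := {p | p ≤ q ∧ ∃ _ : p.IsPrime, map k k B p.ResidueField ω = 0}
  have hS : S.Nonempty := by
    obtain ⟨p, hp, hpq⟩ := Ideal.exists_minimalPrimes_le (I := ⊥) (J := q) bot_le
    have := hp.1.1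
    refine ⟨p, hpq, this, ?_⟩
    obtain ⟨s, hs⟩ := (Submodule.mem_torsion_iff ω).mp hω
    have hsp : (s : B) ∉ p := fun hs' ↦
      Set.disjoint_left.mp (Ideal.disjoint_nonZeroDivisors_of_mem_minimalPrimes hp) hs' s.2
    have h0 : algebraMap B p.ResidueField s ≠ 0 := by
      rwa [Ne, Ideal.algebraMap_residueField_eq_zero]
    refine (smul_eq_zero_iff_right h0).mp ?_
    rw [algebraMap_smul_map]
    exact (congrArg (map k k B p.ResidueField) hs).trans (map_zero _)
  obtain ⟨p, ⟨hpq, hp, hpω⟩, hmax⟩ : ∃ p : Ideal B, p ∈ S ∧ ∀ J ∈ S, ¬ p < J :=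
    set_has_maximal_iff_noetherian.mpr ‹_› S hS
  obtain rfl | hlt := hpq.eq_or_lt
  · exact hpω
  exfalso
  obtain ⟨x, hxq, hxp⟩ := SetLike.exists_of_lt hlt
  obtain ⟨p', hp', hp'q⟩ := Ideal.exists_minimalPrimes_le (I := p ⊔ Ideal.span {x}) (J := q)
    (sup_le hpq ((Ideal.span_singleton_le_iff_mem _).mpr hxq))
  have := hp'.1.1
  have hpp' : p ≤ p' := le_sup_left.trans hp'.1.2
  have hxp' : x ∈ p' := hp'.1.2 (Ideal.mem_sup_right (Ideal.mem_span_singleton_self x))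
  refine hmax p' ⟨hp'q, this, ?_⟩ (lt_of_le_of_ne hpp' fun h ↦ hxp (h ▸ hxp'))
  let f : B ⧸ p →+* p'.ResidueField := Ideal.Quotient.lift p (algebraMap B p'.ResidueField)
    fun a ha ↦ by simpa using hpp' ha
  algebraize [f]
  have : IsScalarTower B (B ⧸ p) p'.ResidueField := .of_algebraMap_eq fun x ↦ rfl
  have : IsScalarTower k (B ⧸ p) p'.ResidueField := .to₁₃₄ k B _ _
  have hker (b : B) : algebraMap (B ⧸ p) p'.ResidueField (Ideal.Quotient.mk p b) = 0 ↔ b ∈ p' :=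
    Ideal.algebraMap_residueField_eq_zero
  rw [← map_map_apply k B (B ⧸ p)]
  refine map_eq_zero_of_ker_mem_minimalPrimes (K := p.ResidueField) (x := Ideal.Quotient.mk p x)
    (by rwa [Ne, Ideal.Quotient.eq_zero_iff_mem]) ⟨⟨RingHom.ker_isPrime _, ?_⟩, ?_⟩ ?_
  · rw [Ideal.span_singleton_le_iff_mem, RingHom.mem_ker, hker]
    exact hxp'
  · rintro r ⟨hr, hxr⟩ hrp y hy
    obtain ⟨b, rfl⟩ := Ideal.Quotient.mk_surjective y
    refine hp'.2 (y := r.comap (Ideal.Quotient.mk p)) ⟨hr.comap _, sup_le ?_ ?_⟩ ?_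
      ((hker b).mp hy)
    · exact fun a ha ↦ by simp [Ideal.Quotient.eq_zero_iff_mem.mpr ha]
    · rw [Ideal.span_singleton_le_iff_mem]
      exact hxr (Ideal.mem_span_singleton_self _)
    · exact fun a ha ↦ (hker a).mp (hrp ha)
  · rwa [map_map_apply]

theorem KaehlerDifferential.mem_torsion_of_forall_minimalPrimes {k A : Type*} [CommRing k]
    [CommRing A] [Algebra k A] [IsReduced A] [IsNoetherianRing A] {ω : Ω[A⁄k]}
    (h : ∀ p ∈ minimalPrimes A, ∀ _ : p.IsPrime, map k k A (Localization.AtPrime p) ω = 0) :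
    ω ∈ Submodule.torsion A (Ω[A⁄k]) := by
  have hfin : (minimalPrimes A).Finite := minimalPrimes.finite_of_isNoetherianRing A
  let I : Ideal A := Submodule.annihilator (Submodule.span A {ω})
  have hI (a : A) : a ∈ I ↔ a • ω = 0 := Submodule.mem_annihilator_span_singleton ω a
  have hnot (p : Ideal A) (hp : p ∈ minimalPrimes A) : ¬ I ≤ p := by
    have := hp.1.1
    obtain ⟨s, hs⟩ := (IsLocalizedModule.eq_zero_iff p.primeCompl
      (map k k A (Localization.AtPrime p))).mp (h p hp this)
    exact fun hle ↦ s.2 (hle ((hI s).mpr hs))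
  obtain ⟨a, haI, ha⟩ : ∃ a ∈ I, ∀ p ∈ minimalPrimes A, a ∉ p := by
    by_contra! hcon
    obtain ⟨p, hp, hle⟩ := (Ideal.subset_union_prime (s := hfin.toFinset) (f := id) ⊥ ⊥
      (fun p hp _ _ ↦ (hfin.mem_toFinset.mp hp).1.1) (I := I)).mp fun a ha ↦ by
        simpa using hcon a ha
    exact hnot p (hfin.mem_toFinset.mp hp) hle
  have ha' : a ∈ nonZeroDivisors A := by
    rw [mem_nonZeroDivisors_iff_right]
    intro b hb
    have : b ∈ nilradical A := by
      rw [nilradical, ← Ideal.sInf_minimalPrimes, Submodule.mem_sInf]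
      exact fun p hp ↦ (hp.1.1.mem_or_mem (hb ▸ p.zero_mem)).resolve_right (ha p hp)
    rwa [nilradical_eq_zero] at this
  exact (Submodule.mem_torsion_iff ω).mpr ⟨⟨a, ha'⟩, (hI a).mp haI⟩

end

/-- Affine form of Corollary 2.7 (p = 1): the pull-back map of Kähler differentials
maps torsion into torsion, and descends uniquely to the torsion-free quotients.
The ℂ-algebra homomorphism `φ : B → A` is encoded by `Algebra B A` with
`IsScalarTower ℂ B A`; "B-linear with target viewed as B-module via φ" is
expressed as semilinearity over the ring homomorphism `algebraMap B A`. -/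
theorem pullback_descends_to_torsion_free_quotients
    (B A : Type*) [CommRing B] [CommRing A]
    [Algebra ℂ B] [Algebra ℂ A] [IsReduced B] [IsReduced A]
    [Algebra.FiniteType ℂ B] [Algebra.FiniteType ℂ A]
    [Algebra B A] [IsScalarTower ℂ B A] :
    (∀ ω ∈ Submodule.torsion B (Ω[B⁄ℂ]),
        KaehlerDifferential.map ℂ ℂ B A ω ∈ Submodule.torsion A (Ω[A⁄ℂ])) ∧
    (∃! g : (Ω[B⁄ℂ] ⧸ Submodule.torsion B (Ω[B⁄ℂ])) →ₛₗ[algebraMap B A]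
            (Ω[A⁄ℂ] ⧸ Submodule.torsion A (Ω[A⁄ℂ])),
      ∀ ω : Ω[B⁄ℂ],
        g ((Submodule.torsion B (Ω[B⁄ℂ])).mkQ ω) =
          (Submodule.torsion A (Ω[A⁄ℂ])).mkQ (KaehlerDifferential.map ℂ ℂ B A ω)) := by
  have htor : ∀ ω ∈ Submodule.torsion B (Ω[B⁄ℂ]),
      KaehlerDifferential.map ℂ ℂ B A ω ∈ Submodule.torsion A (Ω[A⁄ℂ]) := by
    intro ω hω
    have : IsNoetherianRing A := Algebra.FiniteType.isNoetherianRing ℂ A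
    refine KaehlerDifferential.mem_torsion_of_forall_minimalPrimes fun p hp _ ↦ ?_
    rw [KaehlerDifferential.map_map_apply]
    have : Ring.KrullDimLE 0 (Localization.AtPrime p) := .of_isLocalization _ hp _
    have hF : IsField (Localization.AtPrime p) := Ring.KrullDimLE.isField_of_isReduced
    let q := RingHom.ker (algebraMap B (Localization.AtPrime p))
    have : IsDomain (Localization.AtPrime p) := hF.isDomain
    have : q.IsPrime := RingHom.ker_isPrime _
    have : Algebra.EssFiniteType ℂ q.ResidueField := .comp ℂ B _
    exact KaehlerDifferential.map_eq_zero_of_ker_algebraMap_eq (L := q.ResidueField) hF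
      (Ideal.ker_algebraMap_residueField q)
      (KaehlerDifferential.map_residueField_eq_zero_of_mem_torsion hω q)
  refine ⟨htor, ?_⟩
  let m : Ω[B⁄ℂ] →ₛₗ[algebraMap B A] Ω[A⁄ℂ] :=
    { KaehlerDifferential.map ℂ ℂ B A with
      map_smul' := fun b ω ↦ by simp }
  refine ⟨(Submodule.torsion B (Ω[B⁄ℂ])).mapQ (Submodule.torsion A (Ω[A⁄ℂ])) m htor,
    fun ω ↦ rfl, fun g hg ↦ ?_⟩
  refine LinearMap.ext fun x ↦ ?_
  obtain ⟨ω, rfl⟩ := Submodule.mkQ_surjective _ x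
  exact hg ω
end
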